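/- Recursion for f: let g_{k,l,m,n}(N) := I_q(1; {q^{−N−m}}^k, {q^n}^l; q^{−N}) and R_n := 1/(1−q^n). Then for k, m, n ≥ 1, l ≥ 0: g_{k,l,m,n}(N) − g_{k,l,m,n+1}(N−1) = R_{−m−N}·g_{k−1,l,m,n}(N); for k,l,m,n ≥ 1: g_{k,l,m,n}(N) − g_{k,l,m+1,n+1}(N−1) = R_{−m−n−N}·g_{k−1,l,m,n}(N) + R_{m+n+N}·g_{k,l−1,m,n}(N); and for k ≥ 0, l,m,n ≥ 1: g_{k,l,m,n}(N) − g_{k,l,m+1,n}(N−1) = R_{n+N}·g_{k,l−1,m,n}(N). -/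

import Mathlib

/-- `g_{k,l,m,n}(N) = I_q(1; {q^{−N−m}}^k, {q^n}^l; q^{−N})`: the sum over chains
`1 ⊴ t_1 ⊴ ⋯ ⊴ t_{k+l} ⊴ q^{−N}` (i.e. `t_j = q^{−c_j}`, `0 ≤ c_1 ≤ ⋯ ≤ c_{k+l} ≤ N`)
of `∏_{j≤k} t_j/(t_j − q^{−N−m}) · ∏_{j>k} t_j/(t_j − q^n)`. -/
noncomputable def gklmn {K : Type*} [Field K] (q : K) (k l m n N : ℕ) : K :=
  ∑ c ∈ Finset.univ.filter (fun c : Fin (k + l) → Fin (N + 1) =>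
      ∀ i j : Fin (k + l), i ≤ j → c i ≤ c j),
    ∏ j : Fin (k + l),
      q ^ (-((c j : ℕ) : ℤ)) /
        (q ^ (-((c j : ℕ) : ℤ)) -
          (if (j : ℕ) < k then q ^ (-((N : ℤ) + (m : ℤ))) else q ^ (n : ℤ)))

/-- `R_n = 1/(1 − q^n)`. -/
noncomputable def Rq {K : Type*} [Field K] (q : K) (n : ℤ) : K := (1 - q ^ n)⁻¹

local notation "q" => (RatFunc.X : RatFunc ℚ)

section ChainSum

variable {R : Type*} [CommRing R]

/-- The sum over chains `a ≤ c₁ ≤ ⋯ ≤ c_s ≤ M` of `∏ f_j(c_j)`, where `[f₁, …, f_s]` is the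
given list of weights. -/
def chainSum : List (ℕ → R) → ℕ → ℕ → R
  | [], _, _ => 1
  | f :: L, a, M => ∑ c ∈ Finset.Icc a M, f c * chainSum L c M

theorem chainSum_cons (f : ℕ → R) (L : List (ℕ → R)) (a M : ℕ) :
    chainSum (f :: L) a M = ∑ c ∈ Finset.Icc a M, f c * chainSum L c M := rfl

theorem chainSum_eq_zero {L : List (ℕ → R)} (hL : L ≠ []) {a M : ℕ} (h : M < a) :
    chainSum L a M = 0 := by
  cases L with
  | nil => exact absurd rfl hL
  | cons f L => rw [chainSum_cons, Finset.Icc_eq_empty (by omega), Finset.sum_empty]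

/-- Splitting off the chains starting at the lower end. -/
theorem chainSum_cons_eq_add (f : ℕ → R) (L : List (ℕ → R)) {a M : ℕ} (h : a ≤ M) :
    chainSum (f :: L) a M = f a * chainSum L a M + chainSum (f :: L) (a + 1) M := by
  rw [chainSum_cons, chainSum_cons, Finset.Icc_add_one_left_eq_Ioc,
    Finset.add_sum_Ioc_eq_sum_Icc (f := fun c => f c * chainSum L c M) h]

theorem chainSum_map_shift (L : List (ℕ → R)) (a M : ℕ) :
    chainSum (L.map fun f c => f (c + 1)) a M = chainSum L (a + 1) (M + 1) := by
  induction L generalizing a with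
  | nil => rfl
  | cons f L ih =>
    simp only [List.map_cons, chainSum_cons, ih]
    rw [← Finset.map_add_right_Icc a M 1, Finset.sum_map]
    rfl

/-- Splitting off the chains ending at the upper end. -/
theorem chainSum_append_singleton (L : List (ℕ → R)) (f : ℕ → R) {a M : ℕ} (h : a ≤ M + 1) :
    chainSum (L ++ [f]) a (M + 1)
      = chainSum (L ++ [f]) a M + f (M + 1) * chainSum L a (M + 1) := by
  induction L generalizing a with
  | nil => simp [chainSum, Finset.sum_Icc_succ_top h]
  | cons e L ih =>
    simp only [List.cons_append, chainSum_cons]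
    have key : ∀ c ∈ Finset.Icc a (M + 1), e c * chainSum (L ++ [f]) c (M + 1)
        = e c * chainSum (L ++ [f]) c M + f (M + 1) * (e c * chainSum L c (M + 1)) := by
      intro c hc
      rw [ih (Finset.mem_Icc.1 hc).2]
      ring
    rw [Finset.sum_congr rfl key, Finset.sum_add_distrib, ← Finset.mul_sum,
      Finset.sum_Icc_succ_top h fun c => e c * chainSum (L ++ [f]) c M,
      chainSum_eq_zero (by simp) (Nat.lt_succ_self M)]
    ring

/-- Shifting the tail of a chain by one leaves the chains that are strict at the junction; the
remaining ones have two equal entries there. -/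
theorem chainSum_sub_shift_tail (L₁ L₂ : List (ℕ → R)) (f h : ℕ → R) {a M : ℕ} (ha : a ≤ M + 1) :
    chainSum (L₁ ++ f :: h :: L₂) a (M + 1)
        - chainSum (L₁ ++ f :: (h :: L₂).map fun g c => g (c + 1)) a M
      = chainSum (L₁ ++ (fun c => f c * h c) :: L₂) a (M + 1) := by
  induction L₁ generalizing a with
  | nil =>
    simp only [List.nil_append]
    rw [chainSum_cons, chainSum_cons, chainSum_cons]
    simp only [chainSum_map_shift]
    have top := Finset.sum_Icc_succ_top ha fun c => f c * chainSum (h :: L₂) (c + 1) (M + 1)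
    rw [chainSum_eq_zero (by simp) (Nat.lt_succ_self (M + 1)), mul_zero, add_zero] at top
    rw [← top, ← Finset.sum_sub_distrib]
    refine Finset.sum_congr rfl fun c hc => ?_
    rw [chainSum_cons_eq_add h L₂ (Finset.mem_Icc.1 hc).2]
    ring
  | cons e L ih =>
    simp only [List.cons_append]
    rw [chainSum_cons, chainSum_cons, chainSum_cons]
    have top := Finset.sum_Icc_succ_top ha fun c =>
      e c * chainSum (L ++ f :: (h :: L₂).map fun g c => g (c + 1)) c M
    rw [chainSum_eq_zero (by simp) (Nat.lt_succ_self M), mul_zero, add_zero] at top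
    rw [← top, ← Finset.sum_sub_distrib]
    refine Finset.sum_congr rfl fun c hc => ?_
    rw [← ih (Finset.mem_Icc.1 hc).2]
    ring

/-- `chainSum` is linear in each weight. -/
theorem chainSum_linear (L₁ L₂ : List (ℕ → R)) (p f h : ℕ → R) (α β : R) (a M : ℕ)
    (hp : ∀ c ≤ M, p c = α * f c + β * h c) :
    chainSum (L₁ ++ p :: L₂) a M
      = α * chainSum (L₁ ++ f :: L₂) a M + β * chainSum (L₁ ++ h :: L₂) a M := by
  induction L₁ generalizing a with
  | nil =>
    simp only [List.nil_append, chainSum_cons, Finset.mul_sum, ← Finset.sum_add_distrib]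
    refine Finset.sum_congr rfl fun c hc => ?_
    rw [hp c (Finset.mem_Icc.1 hc).2]
    ring
  | cons e L ih =>
    simp only [List.cons_append, chainSum_cons, Finset.mul_sum, ← Finset.sum_add_distrib]
    refine Finset.sum_congr rfl fun c _ => ?_
    rw [ih]
    ring

theorem sum_ite_chain_eq_chainSum (s N a : ℕ) (w : Fin s → ℕ → R) :
    (∑ c : Fin s → Fin (N + 1),
        if (∀ i j, i ≤ j → c i ≤ c j) ∧ ∀ i, a ≤ (c i : ℕ) then ∏ j, w j (c j) else 0)
      = chainSum (List.ofFn w) a N := by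
  induction s generalizing a with
  | zero => simp [chainSum]
  | succ s ih =>
    rw [← (Fin.consEquiv fun _ : Fin (s + 1) => Fin (N + 1)).sum_comp, Fintype.sum_prod_type,
      List.ofFn_succ, chainSum_cons]
    have cond : ∀ (x : Fin (N + 1)) (c : Fin s → Fin (N + 1)),
        ((∀ i j : Fin (s + 1), i ≤ j → (Fin.cons x c : Fin (s + 1) → Fin (N + 1)) i
            ≤ (Fin.cons x c : Fin (s + 1) → Fin (N + 1)) j)
          ∧ ∀ i, a ≤ ((Fin.cons x c : Fin (s + 1) → Fin (N + 1)) i : ℕ))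
        ↔ a ≤ (x : ℕ) ∧ (∀ i j, i ≤ j → c i ≤ c j) ∧ ∀ i, (x : ℕ) ≤ (c i : ℕ) := by
      intro x c
      constructor
      · rintro ⟨h₁, h₂⟩
        refine ⟨h₂ 0, fun i j hij => ?_, fun i => ?_⟩
        · simpa using h₁ i.succ j.succ (Fin.succ_le_succ_iff.2 hij)
        · exact h₁ 0 i.succ (Fin.zero_le _)
      · rintro ⟨h₁, h₂, h₃⟩
        refine ⟨fun i j => ?_, fun i => ?_⟩
        · induction i using Fin.cases with
          | zero =>
            induction j using Fin.cases with
            | zero => simp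
            | succ j => exact fun _ => h₃ j
          | succ i =>
            induction j using Fin.cases with
            | zero => exact fun h => absurd h (by simp)
            | succ j => simpa using h₂ i j
        · induction i using Fin.cases with
          | zero => exact h₁
          | succ i => exact h₁.trans (h₃ i)
    have inner : ∀ x : Fin (N + 1),
        (∑ c : Fin s → Fin (N + 1),
          if (∀ i j : Fin (s + 1), i ≤ j → (Fin.cons x c : Fin (s + 1) → Fin (N + 1)) i
              ≤ (Fin.cons x c : Fin (s + 1) → Fin (N + 1)) j)
            ∧ ∀ i, a ≤ ((Fin.cons x c : Fin (s + 1) → Fin (N + 1)) i : ℕ)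
          then ∏ j, w j ((Fin.cons x c : Fin (s + 1) → Fin (N + 1)) j) else 0)
        = if a ≤ (x : ℕ) then w 0 x * chainSum (List.ofFn fun i => w i.succ) x N else 0 := by
      intro x
      simp only [cond, Fin.prod_univ_succ, Fin.cons_zero, Fin.cons_succ]
      rw [← ih]
      split_ifs with hx
      · simp only [hx, true_and, Finset.mul_sum, mul_ite, mul_zero]
      · simp [hx]
    refine (Finset.sum_congr rfl fun x _ => inner x).trans ?_
    rw [Fin.sum_univ_eq_sum_range (fun x => if a ≤ x then
      w 0 x * chainSum (List.ofFn fun i => w i.succ) x N else 0) (N + 1), ← Finset.sum_filter]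
    refine Finset.sum_congr ?_ fun _ _ => rfl
    ext x
    simp only [Finset.mem_filter, Finset.mem_range, Finset.mem_Icc]
    omega

end ChainSum

section Field

variable {K : Type*} [Field K]

theorem zpow_neg_div_sub_eq_Rq {x : K} (hx : x ≠ 0) (c e : ℤ) :
    x ^ (-c) / (x ^ (-c) - x ^ e) = Rq x (e + c) := by
  have h : x ^ (-c) - x ^ e = x ^ (-c) * (1 - x ^ (e + c)) := by
    rw [mul_sub, mul_one, ← zpow_add₀ hx]
    congr 2
    ring
  rw [h, div_mul_eq_div_div, div_self (zpow_ne_zero _ hx), one_div, Rq]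

theorem gklmn_eq_chainSum {x : K} (hx : x ≠ 0) (k l m n N : ℕ) :
    gklmn x k l m n N
      = chainSum (List.replicate k (fun c : ℕ => Rq x (c - N - m))
          ++ List.replicate l fun c : ℕ => Rq x (n + c)) 0 N := by
  have hlist : List.ofFn (fun (j : Fin (k + l)) (c : ℕ) =>
        if (j : ℕ) < k then Rq x ((c : ℤ) - N - m) else Rq x (n + c))
      = List.replicate k (fun c : ℕ => Rq x (c - N - m))
          ++ List.replicate l fun c : ℕ => Rq x (n + c) := by
    refine List.ext_getElem (by simp) fun i h₁ h₂ => ?_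
    by_cases hi : i < k <;> simp [List.getElem_append, hi]
  rw [← hlist, ← sum_ite_chain_eq_chainSum, gklmn, Finset.sum_filter]
  refine Finset.sum_congr rfl fun c _ => ?_
  simp only [Nat.zero_le, implies_true, and_true]
  refine if_congr Iff.rfl (Finset.prod_congr rfl fun j _ => ?_) rfl
  split_ifs
  · rw [zpow_neg_div_sub_eq_Rq hx]
    congr 1
    ring
  · rw [zpow_neg_div_sub_eq_Rq hx]

theorem Rq_mul_Rq {x : K} (hx : x ≠ 0) {a b : ℤ} (ha : x ^ a ≠ 1) (hb : x ^ b ≠ 1)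
    (hab : x ^ a ≠ x ^ b) :
    Rq x a * Rq x b = Rq x (b - a) * Rq x a + Rq x (a - b) * Rq x b := by
  have ha' : 1 - x ^ a ≠ 0 := sub_ne_zero.2 ha.symm
  have hb' : 1 - x ^ b ≠ 0 := sub_ne_zero.2 hb.symm
  have h₁ : x ^ a - x ^ b ≠ 0 := sub_ne_zero.2 hab
  have h₂ : x ^ b - x ^ a ≠ 0 := sub_ne_zero.2 hab.symm
  have hxa := zpow_ne_zero a hx
  have hxb := zpow_ne_zero b hx
  have e₁ : Rq x (b - a) = x ^ a / (x ^ a - x ^ b) := by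
    rw [Rq, zpow_sub₀ hx, one_sub_div hxa, inv_div]
  have e₂ : Rq x (a - b) = - (x ^ b / (x ^ a - x ^ b)) := by
    rw [Rq, zpow_sub₀ hx, one_sub_div hxb, inv_div, ← div_neg, neg_sub]
  rw [e₁, e₂, Rq, Rq]
  field_simp
  ring

end Field

theorem RatFunc.X_zpow_ne_one {F : Type*} [Field F] {a : ℤ} (ha : a ≠ 0) :
    (RatFunc.X : RatFunc F) ^ a ≠ 1 := by
  have key : ∀ d : ℕ, d ≠ 0 → (RatFunc.X : RatFunc F) ^ d ≠ 1 := by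
    intro d hd h
    rw [← RatFunc.algebraMap_X, ← map_pow, ← map_one (algebraMap (Polynomial F) (RatFunc F))] at h
    have := congrArg Polynomial.natDegree (RatFunc.algebraMap_injective F h)
    rw [Polynomial.natDegree_X_pow, Polynomial.natDegree_one] at this
    exact hd this
  obtain ⟨d, rfl | rfl⟩ := a.eq_nat_or_neg
  · rw [zpow_natCast]
    exact key d (by omega)
  · rw [zpow_neg, zpow_natCast, Ne, inv_eq_one]
    exact key d (by omega)

/-- **The recursions (4.3)–(4.5) of the paper** for
`g_{k,l,m,n}(N) = I_q(1; {q^{−N−m}}^k, {q^n}^l; q^{−N})` in `ℚ(q)` (stated with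
`k+1, l+1, m+1, n+1, N+1` in place of the respective variables, encoding
`k,m,n ≥ 1, l ≥ 0` / `k,l,m,n ≥ 1` / `k ≥ 0, l,m,n ≥ 1`, and `N ≥ 1`):
`g_{k,l,m,n}(N) − g_{k,l,m,n+1}(N−1) = R_{−m−N} g_{k−1,l,m,n}(N)`,
`g_{k,l,m,n}(N) − g_{k,l,m+1,n+1}(N−1) = R_{−m−n−N} g_{k−1,l,m,n}(N)
   + R_{m+n+N} g_{k,l−1,m,n}(N)`, and
`g_{k,l,m,n}(N) − g_{k,l,m+1,n}(N−1) = R_{n+N} g_{k,l−1,m,n}(N)`. -/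
theorem gklmn_recursions (k l m n N : ℕ) :
    (gklmn q (k + 1) l (m + 1) (n + 1) (N + 1)
        - gklmn q (k + 1) l (m + 1) (n + 2) N
      = Rq q (-((m : ℤ) + 1) - ((N : ℤ) + 1))
          * gklmn q k l (m + 1) (n + 1) (N + 1)) ∧
    (gklmn q (k + 1) (l + 1) (m + 1) (n + 1) (N + 1)
        - gklmn q (k + 1) (l + 1) (m + 2) (n + 2) N
      = Rq q (-((m : ℤ) + 1) - ((n : ℤ) + 1) - ((N : ℤ) + 1))
            * gklmn q k (l + 1) (m + 1) (n + 1) (N + 1)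
          + Rq q (((m : ℤ) + 1) + ((n : ℤ) + 1) + ((N : ℤ) + 1))
            * gklmn q (k + 1) l (m + 1) (n + 1) (N + 1)) ∧
    (gklmn q k (l + 1) (m + 1) (n + 1) (N + 1)
        - gklmn q k (l + 1) (m + 2) (n + 1) N
      = Rq q (((n : ℤ) + 1) + ((N : ℤ) + 1))
          * gklmn q k l (m + 1) (n + 1) (N + 1)) := by
  have hX : (q) ≠ 0 := RatFunc.X_ne_zero
  simp only [gklmn_eq_chainSum hX]
  refine ⟨?_, ?_, ?_⟩
  · have hshift := chainSum_map_shift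
      (List.replicate (k + 1) (fun c : ℕ => Rq q (c - (N + 1 : ℕ) - (m + 1 : ℕ)))
        ++ List.replicate l fun c : ℕ => Rq q ((n + 1 : ℕ) + c)) 0 N
    simp only [List.map_append, List.map_replicate] at hshift
    have e₁ : (fun c : ℕ => Rq q (c - N - (m + 1 : ℕ)))
        = fun c : ℕ => Rq q ((c + 1 : ℕ) - (N + 1 : ℕ) - (m + 1 : ℕ)) := by
      funext c; congr 1; push_cast; ring
    have e₂ : (fun c : ℕ => Rq q ((n + 2 : ℕ) + c))
        = fun c : ℕ => Rq q ((n + 1 : ℕ) + (c + 1 : ℕ)) := by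
      funext c; congr 1; push_cast; ring
    rw [e₁, e₂, hshift, List.replicate_succ, List.cons_append,
      chainSum_cons_eq_add _ _ (Nat.zero_le _), add_sub_cancel_right]
    congr 2
    push_cast; ring
  · have e₁ : (fun c : ℕ => Rq q (c - N - (m + 2 : ℕ)))
        = fun c : ℕ => Rq q (c - (N + 1 : ℕ) - (m + 1 : ℕ)) := by
      funext c; congr 1; push_cast; ring
    have e₂ : (fun c : ℕ => Rq q ((n + 2 : ℕ) + c))
        = fun c : ℕ => Rq q ((n + 1 : ℕ) + (c + 1 : ℕ)) := by
      funext c; congr 1; push_cast; ring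
    rw [e₁, e₂]
    set f := fun c : ℕ => Rq q (c - (N + 1 : ℕ) - (m + 1 : ℕ)) with hf
    set h := fun c : ℕ => Rq q ((n + 1 : ℕ) + c) with hh
    have hsub := chainSum_sub_shift_tail (List.replicate k f) (List.replicate l h) f h
      (Nat.zero_le (N + 1))
    rw [chainSum_linear _ _ (fun c => f c * h c) h f (Rq q (-((m : ℤ) + 1) - ((n : ℤ) + 1) - ((N : ℤ) + 1)))
      (Rq q (((m : ℤ) + 1) + ((n : ℤ) + 1) + ((N : ℤ) + 1)))] at hsub
    · simp only [List.map_cons, List.map_replicate] at hsub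
      simp only [List.replicate_succ' (n := k), List.append_assoc, List.singleton_append,
        List.replicate_succ (n := l)]
      exact hsub
    · intro c hc
      simp only [hf, hh]
      rw [Rq_mul_Rq hX (RatFunc.X_zpow_ne_one (by omega)) (RatFunc.X_zpow_ne_one (by omega)),
        add_comm (_ * _)]
      · congr 3 <;> push_cast <;> ring
      · intro heq
        rw [← div_eq_one_iff_eq (zpow_ne_zero _ hX), ← zpow_sub₀ hX] at heq
        exact RatFunc.X_zpow_ne_one (by omega) heq
  · have e₁ : (fun c : ℕ => Rq q (c - N - (m + 2 : ℕ)))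
        = fun c : ℕ => Rq q (c - (N + 1 : ℕ) - (m + 1 : ℕ)) := by
      funext c; congr 1; push_cast; ring
    rw [e₁, List.replicate_succ', ← List.append_assoc,
      chainSum_append_singleton _ _ (Nat.zero_le _), add_sub_cancel_left]
    congr 2
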